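/- arXiv:1802.08229 — 3 statements merged into one kernel-verified Lean document; each statement's English description precedes it below -/
import Mathlib

section
/- For all integers N ≥ 2, C ≥ 2 and all α ∈ (0,1), the ratio R = sqrt((C−1)/C) · t_{C(N−1), α/2} / t_{(N−1)(C−1), α/2} satisfies R < 1, where t_{d, α/2} denotes the upper α/2 quantile of the t-distribution with d degrees of freedom. Consequently the new within-subject HDI M_·j ± sqrt(SS_{S×C}/(N(N−1)C))·t_{C(N−1), α/2} is strictly shorter than the Loftus–Masson interval M_·j ± sqrt(SS_{S×C}/(N(N−1)(C−1)))·t_{(N−1)(C−1), α/2}. -/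
open MeasureTheory Set

/-- Density of the standard t-distribution with `d` degrees of freedom. -/
noncomputable def stdTPdf (d : ℝ) (x : ℝ) : ℝ :=
  Real.Gamma ((d + 1) / 2) / (Real.sqrt (d * Real.pi) * Real.Gamma (d / 2))
    * (1 + x ^ 2 / d) ^ (-((d + 1) / 2))

/-- The standard t-distribution with `d` degrees of freedom as a measure on `ℝ`. -/
noncomputable def stdT (d : ℝ) : Measure ℝ :=
  (volume : Measure ℝ).withDensity fun x => ENNReal.ofReal (stdTPdf d x)


lemma tAux_norm (s : ℝ) (hs : 1 / 2 < s) :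
    ∫⁻ x in Ioi (0 : ℝ), ENNReal.ofReal (Real.Gamma s * (1 + x ^ 2) ^ (-s))
      = ENNReal.ofReal (Real.sqrt Real.pi / 2 * Real.Gamma (s - 1 / 2)) := by
  have hs0 : 0 < s := by linarith
  have hG : 0 < Real.Gamma s := Real.Gamma_pos_of_pos hs0
  have hG' : 0 < Real.Gamma (s - 1 / 2) := Real.Gamma_pos_of_pos (by linarith)
  have h1 : ∀ x : ℝ, ENNReal.ofReal (Real.Gamma s * (1 + x ^ 2) ^ (-s))
      = ∫⁻ t in Ioi (0 : ℝ), ENNReal.ofReal (t ^ (s - 1) * Real.exp (-((1 + x ^ 2) * t))) := by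
    intro x
    have hx : 0 < 1 + x ^ 2 := by positivity
    have e := Real.integral_rpow_mul_exp_neg_mul_Ioi hs0 hx
    have e2 : (1 / (1 + x ^ 2)) ^ s = (1 + x ^ 2) ^ (-s) := by
      rw [one_div, Real.inv_rpow hx.le, Real.rpow_neg hx.le]
    rw [e2, mul_comm] at e
    rw [← e, ofReal_integral_eq_lintegral_ofReal]
    · refine not_imp_comm.1 integral_undef ?_
      rw [e]; positivity
    · refine (ae_restrict_iff' measurableSet_Ioi).2 (Filter.Eventually.of_forall fun t ht => ?_)
      have ht : (0 : ℝ) < t := ht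
      simp only [Pi.zero_apply]; positivity
  simp_rw [h1]
  rw [lintegral_lintegral_swap (by
    apply Measurable.aemeasurable
    unfold Function.uncurry
    fun_prop)]
  have h2 : ∀ t ∈ Ioi (0 : ℝ),
      ∫⁻ x in Ioi (0 : ℝ), ENNReal.ofReal (t ^ (s - 1) * Real.exp (-((1 + x ^ 2) * t)))
      = ENNReal.ofReal (Real.sqrt Real.pi / 2 *
          (t ^ (s - 1 / 2 - 1) * Real.exp (-(1 * t)))) := by
    intro t ht
    have ht : (0 : ℝ) < t := ht
    have e := integral_gaussian_Ioi t
    have e3 : ∫ x in Ioi (0 : ℝ), t ^ (s - 1) * Real.exp (-((1 + x ^ 2) * t))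
        = Real.sqrt Real.pi / 2 * (t ^ (s - 1 / 2 - 1) * Real.exp (-(1 * t))) := by
      have : ∀ x : ℝ, t ^ (s - 1) * Real.exp (-((1 + x ^ 2) * t))
          = (t ^ (s - 1) * Real.exp (-(1 * t))) * Real.exp (-t * x ^ 2) := by
        intro x
        rw [mul_assoc, ← Real.exp_add]; congr 2; ring
      simp_rw [this]
      rw [integral_const_mul, e, Real.sqrt_div Real.pi_pos.le,
        show s - 1 / 2 - 1 = (s - 1) - 1 / 2 by ring, Real.rpow_sub ht (s - 1) (1 / 2),
        ← Real.sqrt_eq_rpow]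
      ring
    rw [← e3, ofReal_integral_eq_lintegral_ofReal]
    · refine not_imp_comm.1 integral_undef ?_
      rw [e3]; positivity
    · refine Filter.Eventually.of_forall fun x => ?_
      simp only [Pi.zero_apply]; positivity
  rw [setLIntegral_congr_fun measurableSet_Ioi h2]
  have e := Real.integral_rpow_mul_exp_neg_mul_Ioi (a := s - 1 / 2) (r := 1) (by linarith) one_pos
  have e4 : ∫ t in Ioi (0 : ℝ), Real.sqrt Real.pi / 2 *
      (t ^ (s - 1 / 2 - 1) * Real.exp (-(1 * t)))
      = Real.sqrt Real.pi / 2 * Real.Gamma (s - 1 / 2) := by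
    rw [integral_const_mul, e]; simp
  rw [← e4, ofReal_integral_eq_lintegral_ofReal]
  · refine not_imp_comm.1 integral_undef ?_
    rw [e4]; positivity
  · refine (ae_restrict_iff' measurableSet_Ioi).2 (Filter.Eventually.of_forall fun t ht => ?_)
    have ht : (0 : ℝ) < t := ht
    simp only [Pi.zero_apply]; positivity

lemma tAux_norm' (s : ℝ) (hs : 1 / 2 < s) :
    ∫ x in Ioi (0 : ℝ), (1 + x ^ 2) ^ (-s)
      = Real.sqrt Real.pi / 2 * Real.Gamma (s - 1 / 2) / Real.Gamma s := by
  have hG : 0 < Real.Gamma s := Real.Gamma_pos_of_pos (by linarith)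
  have hG' : 0 < Real.Gamma (s - 1 / 2) := Real.Gamma_pos_of_pos (by linarith)
  have h := tAux_norm s hs
  rw [eq_div_iff hG.ne', mul_comm, ← integral_const_mul, integral_eq_lintegral_of_nonneg_ae, h,
    ENNReal.toReal_ofReal (by positivity)]
  · refine Filter.Eventually.of_forall fun x => ?_
    simp only [Pi.zero_apply]; positivity
  · apply Measurable.aestronglyMeasurable
    fun_prop

/-- scaled t density -/
noncomputable def tAuxF (d u : ℝ) : ℝ :=
  Real.Gamma ((d + 1) / 2) / (Real.sqrt Real.pi * Real.Gamma (d / 2)) *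
    (1 + u ^ 2) ^ (-((d + 1) / 2))

lemma tAuxF_pos (d : ℝ) (hd : 0 < d) (u : ℝ) : 0 < tAuxF d u := by
  have hG : 0 < Real.Gamma ((d + 1) / 2) := Real.Gamma_pos_of_pos (by linarith)
  have hG' : 0 < Real.Gamma (d / 2) := Real.Gamma_pos_of_pos (by linarith)
  unfold tAuxF
  positivity

lemma tAuxF_int0 (d : ℝ) (hd : 0 < d) : ∫ u in Ioi (0 : ℝ), tAuxF d u = 1 / 2 := by
  have hG : 0 < Real.Gamma ((d + 1) / 2) := Real.Gamma_pos_of_pos (by linarith)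
  have hG' : 0 < Real.Gamma (d / 2) := Real.Gamma_pos_of_pos (by linarith)
  unfold tAuxF
  rw [integral_const_mul, tAux_norm' _ (by linarith),
    show (d + 1) / 2 - 1 / 2 = d / 2 by ring]
  have : 0 < Real.sqrt Real.pi := Real.sqrt_pos.2 Real.pi_pos
  field_simp

lemma tAuxF_integrable (d : ℝ) (hd : 0 < d) : Integrable (tAuxF d) := by
  have h0 : IntegrableOn (tAuxF d) (Ioi 0) := by
    refine not_imp_comm.1 integral_undef ?_
    rw [tAuxF_int0 d hd]; norm_num
  have h0' : IntegrableOn (tAuxF d) (Iic 0) := by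
    rw [integrableOn_Iic_iff_integrableOn_Iio]
    rw [← neg_zero] at h0
    have h1 := h0.comp_neg_Iio
    have h2 : (fun x => tAuxF d (-x)) = tAuxF d := by funext x; simp [tAuxF]
    rwa [h2] at h1
  have := h0'.union h0
  rwa [Iic_union_Ioi, integrableOn_univ] at this

lemma tAux_stdT (d : ℝ) (hd : 0 < d) (t p : ℝ) (hp : 0 ≤ p)
    (h : stdT d (Ioi t) = ENNReal.ofReal p) :
    ∫ u in Ioi (t / Real.sqrt d), tAuxF d u = p := by
  have hsd : 0 < Real.sqrt d := Real.sqrt_pos.2 hd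
  have hpdf : ∀ x, stdTPdf d x = (Real.sqrt d)⁻¹ * tAuxF d ((Real.sqrt d)⁻¹ * x) := by
    intro x
    unfold stdTPdf tAuxF
    rw [mul_pow, inv_pow, Real.sq_sqrt hd.le, Real.sqrt_mul hd.le,
      show (d⁻¹ * x ^ 2) = x ^ 2 / d by ring]
    have : 0 < Real.sqrt Real.pi := Real.sqrt_pos.2 Real.pi_pos
    have hG' : 0 < Real.Gamma (d / 2) := Real.Gamma_pos_of_pos (by linarith)
    field_simp
  have hpos : ∀ x, 0 ≤ stdTPdf d x := fun x => by
    rw [hpdf]; exact mul_nonneg (by positivity) (tAuxF_pos d hd _).le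
  have hint : ∫ x in Ioi t, stdTPdf d x = p := by
    rw [integral_eq_lintegral_of_nonneg_ae (Filter.Eventually.of_forall hpos)]
    · unfold stdT at h
      rw [withDensity_apply _ measurableSet_Ioi] at h
      rw [h, ENNReal.toReal_ofReal hp]
    · apply Measurable.aestronglyMeasurable
      unfold stdTPdf
      fun_prop
  simp_rw [hpdf] at hint
  rw [integral_const_mul, integral_comp_mul_left_Ioi _ _ (inv_pos.2 hsd)] at hint
  rw [inv_inv, smul_eq_mul, inv_mul_cancel_left₀ hsd.ne'] at hint
  rwa [div_eq_inv_mul]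

lemma tAux_split (d : ℝ) (hd : 0 < d) (u : ℝ) (hu : 0 ≤ u) :
    (∫ x in Ioc 0 u, tAuxF d x) + ∫ x in Ioi u, tAuxF d x = 1 / 2 := by
  have hi := tAuxF_integrable d hd
  rw [← setIntegral_union (Ioc_disjoint_Ioi le_rfl) measurableSet_Ioi hi.integrableOn
    hi.integrableOn, Ioc_union_Ioi_eq_Ioi hu, tAuxF_int0 d hd]

lemma tAux_strict {f g : ℝ → ℝ} {S : Set ℝ} (hS : MeasurableSet S) (hv : 0 < volume S)
    (hf : Integrable f) (hg : Integrable g) (h : ∀ x ∈ S, f x < g x) :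
    ∫ x in S, f x < ∫ x in S, g x := by
  have : 0 < ∫ x in S, (g x - f x) := by
    rw [setIntegral_pos_iff_support_of_nonneg_ae]
    · refine hv.trans_le (measure_mono fun x hx => ⟨?_, hx⟩)
      exact (sub_pos.2 (h x hx)).ne'
    · exact (ae_restrict_iff' hS).2 (Filter.Eventually.of_forall fun x hx => (sub_pos.2 (h x hx)).le)
    · exact (hg.sub hf).integrableOn
  rw [integral_sub hg.integrableOn hf.integrableOn] at this
  linarith

lemma tAux_ratio (a b : ℝ) (hb : 0 < b) (hab : b < a) (x y : ℝ) (hx : 0 ≤ x) (hxy : x < y) :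
    tAuxF a y * tAuxF b x < tAuxF a x * tAuxF b y := by
  have key : ∀ z, tAuxF a z = (tAuxF a 0 / tAuxF b 0) * (1 + z ^ 2) ^ (-((a - b) / 2)) * tAuxF b z := by
    intro z
    have h1 : 0 < Real.Gamma ((b + 1) / 2) := Real.Gamma_pos_of_pos (by linarith)
    have h2 : 0 < Real.Gamma (b / 2) := Real.Gamma_pos_of_pos (by linarith)
    have h3 : 0 < Real.Gamma (a / 2) := Real.Gamma_pos_of_pos (by linarith)
    have : 0 < Real.sqrt Real.pi := Real.sqrt_pos.2 Real.pi_pos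
    have hz : 0 < 1 + z ^ 2 := by positivity
    unfold tAuxF
    rw [show -((a + 1) / 2) = -((a - b) / 2) + -((b + 1) / 2) by ring, Real.rpow_add hz]
    simp only [ne_eq, OfNat.ofNat_ne_zero, not_false_eq_true, zero_pow, add_zero, Real.one_rpow, mul_one]
    field_simp
  have ha0 := tAuxF_pos a (hb.trans hab) 0
  have hb0 := tAuxF_pos b hb 0
  have hbx := tAuxF_pos b hb x
  have hby := tAuxF_pos b hb y
  rw [key x, key y]
  have hlt : (1 + y ^ 2) ^ (-((a - b) / 2)) < (1 + x ^ 2) ^ (-((a - b) / 2)) := by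
    apply Real.rpow_lt_rpow_of_neg (by positivity) (by nlinarith) (by linarith)
  have : 0 < (tAuxF a 0 / tAuxF b 0) * (tAuxF b x * tAuxF b y) := by positivity
  have := mul_lt_mul_of_pos_left hlt this
  linarith

lemma tAux_tail (a b : ℝ) (hb : 0 < b) (hab : b < a) (u : ℝ) (hu : 0 < u) :
    ∫ x in Ioi u, tAuxF a x < ∫ x in Ioi u, tAuxF b x := by
  have ha := hb.trans hab
  have ia := tAuxF_integrable a ha
  have ib := tAuxF_integrable b hb
  have hau := tAuxF_pos a ha u
  have hbu := tAuxF_pos b hb u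
  rcases le_or_gt (tAuxF a u) (tAuxF b u) with h | h
  · refine tAux_strict measurableSet_Ioi (by simp) ia ib fun y hy => ?_
    have := tAux_ratio a b hb hab u y hu.le hy
    have hby := tAuxF_pos b hb y
    by_contra! hc
    nlinarith [mul_le_mul hc h hau.le (hby.le.trans hc)]
  · have : ∫ x in Ioo 0 u, tAuxF b x < ∫ x in Ioo 0 u, tAuxF a x := by
      refine tAux_strict measurableSet_Ioo (by simpa using hu) ib ia fun y hy => ?_
      have := tAux_ratio a b hb hab y u hy.1.le hy.2
      have hby := tAuxF_pos b hb y
      by_contra! hc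
      nlinarith [mul_le_mul hc h.le hbu.le hby.le]
    rw [← integral_Ioc_eq_integral_Ioo, ← integral_Ioc_eq_integral_Ioo] at this
    linarith [tAux_split a ha u hu.le, tAux_split b hb u hu.le]

lemma tAux_anti (d : ℝ) (hd : 0 < d) (u v : ℝ) (h : u ≤ v) :
    ∫ x in Ioi v, tAuxF d x ≤ ∫ x in Ioi u, tAuxF d x :=
  setIntegral_mono_set (tAuxF_integrable d hd).integrableOn
    (Filter.Eventually.of_forall fun x => (tAuxF_pos d hd x).le)
    (Ioi_subset_Ioi h).eventuallyLE

/-- For `N, C ≥ 2` and `α ∈ (0,1)`, with `tA = t_{C(N−1), α/2}` and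
`tB = t_{(N−1)(C−1), α/2}`, the length ratio
`R = sqrt((C−1)/C) · tA / tB` is `< 1`; consequently the new within-subject HDI
`M_·j ± sqrt(SS/(N(N−1)C))·tA` is strictly shorter than the Loftus–Masson interval
`M_·j ± sqrt(SS/(N(N−1)(C−1)))·tB`. -/
theorem length_ratio_lt_one (N C : ℕ) (hN : 2 ≤ N) (hC : 2 ≤ C)
    (α : ℝ) (hα : α ∈ Set.Ioo (0 : ℝ) 1) (tA tB : ℝ)
    (hA : stdT ((C : ℝ) * ((N : ℝ) - 1)) (Set.Ioi tA) = ENNReal.ofReal (α / 2))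
    (hB : stdT (((N : ℝ) - 1) * ((C : ℝ) - 1)) (Set.Ioi tB) = ENNReal.ofReal (α / 2))
    (SS : ℝ) (hSS : 0 < SS) :
    Real.sqrt (((C : ℝ) - 1) / C) * tA / tB < 1 ∧
      Real.sqrt (SS / ((N : ℝ) * ((N : ℝ) - 1) * C)) * tA
        < Real.sqrt (SS / ((N : ℝ) * ((N : ℝ) - 1) * ((C : ℝ) - 1))) * tB := by
  have hN' : (2 : ℝ) ≤ N := by exact_mod_cast hN
  have hC' : (2 : ℝ) ≤ C := by exact_mod_cast hC
  obtain ⟨hα0, hα1⟩ := hα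
  have hn : 0 < (N : ℝ) - 1 := by linarith
  have hc : 0 < (C : ℝ) - 1 := by linarith
  have hC0 : 0 < (C : ℝ) := by linarith
  have hN0 : 0 < (N : ℝ) := by linarith
  set a := (C : ℝ) * ((N : ℝ) - 1) with ha
  set b := ((N : ℝ) - 1) * ((C : ℝ) - 1) with hb
  have hb0 : 0 < b := by positivity
  have hab : b < a := by rw [ha, hb]; nlinarith
  have ha0 : 0 < a := hb0.trans hab
  have sa : 0 < Real.sqrt a := Real.sqrt_pos.2 ha0
  have sb : 0 < Real.sqrt b := Real.sqrt_pos.2 hb0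
  have iA := tAux_stdT a ha0 tA (α / 2) (by linarith) hA
  have iB := tAux_stdT b hb0 tB (α / 2) (by linarith) hB
  have uB : 0 < tB / Real.sqrt b := by
    by_contra! h
    have := tAux_anti b hb0 _ _ h
    rw [tAuxF_int0 b hb0, iB] at this
    linarith
  have uAB : tA / Real.sqrt a < tB / Real.sqrt b := by
    by_contra! h
    have h1 := tAux_anti a ha0 _ _ h
    have h2 := tAux_tail a b hb0 hab _ uB
    rw [iA] at h1
    rw [iB] at h2
    linarith
  have htB : 0 < tB := by
    have := mul_pos uB sb
    rwa [div_mul_cancel₀ _ sb.ne'] at this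
  constructor
  · rw [div_lt_one htB]
    have e : Real.sqrt (((C : ℝ) - 1) / C) = Real.sqrt b / Real.sqrt a := by
      rw [← Real.sqrt_div hb0.le]; congr 1; rw [ha, hb]; field_simp
    have := mul_lt_mul_of_pos_left uAB sb
    rw [mul_div_cancel₀ _ sb.ne'] at this
    rw [e]
    calc _ = Real.sqrt b * (tA / Real.sqrt a) := by ring
      _ < tB := this
  · have e1 : Real.sqrt (SS / ((N : ℝ) * ((N : ℝ) - 1) * C)) = Real.sqrt (SS / N) / Real.sqrt a := by
      rw [← Real.sqrt_div (by positivity)]; congr 1; rw [ha]; field_simp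
    have e2 : Real.sqrt (SS / ((N : ℝ) * ((N : ℝ) - 1) * ((C : ℝ) - 1)))
        = Real.sqrt (SS / N) / Real.sqrt b := by
      rw [← Real.sqrt_div (by positivity)]; congr 1; rw [hb]; field_simp
    have s : 0 < Real.sqrt (SS / N) := Real.sqrt_pos.2 (by positivity)
    rw [e1, e2, div_mul_eq_mul_div, div_mul_eq_mul_div, mul_div_assoc, mul_div_assoc]
    exact mul_lt_mul_of_pos_left uAB s
end

section
/- In the homoscedastic mixed model with the improper prior π(μ, σ_ε²) ∝ (σ_ε²)^((N−3)/2), the conditional posterior of μ_j given the data and the plug-in random effects b̂_i = M_i· − M is a univariate t-distribution with (N−1)(C−1) degrees of freedom, location M_·j, and scale SS_{S×C}/(N(N−1)(C−1)). Hence the resulting 1−α within-subject HDI is exactly the Loftus–Masson interval M_·j ± sqrt(SS_{S×C}/(N(N−1)(C−1)))·t_{(N−1)(C−1), α/2}. -/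
open Finset MeasureTheory Set

/-- Subject mean `M_i·`. -/
noncomputable def subjMean (N C : ℕ) (Y : Fin N → Fin C → ℝ) (i : Fin N) : ℝ :=
  (∑ j, Y i j) / C

/-- Condition mean `M_·j`. -/
noncomputable def condMean (N C : ℕ) (Y : Fin N → Fin C → ℝ) (j : Fin C) : ℝ :=
  (∑ i, Y i j) / N

/-- Grand mean `M`. -/
noncomputable def grandMean (N C : ℕ) (Y : Fin N → Fin C → ℝ) : ℝ :=
  (∑ i, ∑ j, Y i j) / (N * C)

/-- Plug-in random-effect estimate `b̂_i = M_i· − M`. -/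
noncomputable def bhat (N C : ℕ) (Y : Fin N → Fin C → ℝ) (i : Fin N) : ℝ :=
  subjMean N C Y i - grandMean N C Y

/-- Interaction sum of squares `SS_{S×C}`. -/
noncomputable def SSint (N C : ℕ) (Y : Fin N → Fin C → ℝ) : ℝ :=
  ∑ i, ∑ j, (Y i j) ^ 2 - C * ∑ i, (subjMean N C Y i) ^ 2
    - N * ∑ j, (condMean N C Y j) ^ 2 + C * N * (grandMean N C Y) ^ 2

lemma lm_lint_pi (n : ℕ) (f : Fin n → ℝ → ENNReal) (hf : ∀ i, Measurable (f i)) :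
    ∫⁻ x : Fin n → ℝ, ∏ i, f i (x i) = ∏ i, ∫⁻ x, f i x := by
  induction n with
  | zero => simp [MeasureTheory.lintegral_const, volume_pi]
  | succ n ih =>
    have h := (volume_preserving_piFinSuccAbove (fun _ : Fin (n+1) => ℝ) 0).symm
    rw [← h.lintegral_comp_emb (MeasurableEquiv.measurableEmbedding _)]
    simp only [Fin.prod_univ_succ]
    rw [← ih (fun i => f i.succ) (fun i => hf _)]
    rw [← lintegral_prod_mul (hf 0).aemeasurable]
    · rfl
    · exact (Finset.measurable_prod _ (fun i _ => (hf i.succ).comp (measurable_pi_apply i))).aemeasurable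

lemma lm_invgamma (a B : ℝ) (ha : 0 < a) (hB : 0 < B) :
    IntegrableOn (fun s : ℝ => s ^ (-a - 1) * Real.exp (-(B / s))) (Ioi 0) ∧
    ∫ s in Ioi (0:ℝ), s ^ (-a - 1) * Real.exp (-(B / s)) = Real.Gamma a * B ^ (-a) := by
  have key : ∀ s ∈ Ioi (0:ℝ), (|(-1:ℝ)| * s ^ ((-1:ℝ) - 1)) •
      ((fun t : ℝ => t ^ (a - 1) * Real.exp (-(B * t))) (s ^ (-1:ℝ)))
      = s ^ (-a - 1) * Real.exp (-(B / s)) := by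
    intro s hs
    have hs : 0 < s := hs
    simp only [abs_neg, abs_one, one_mul, smul_eq_mul]
    rw [← Real.rpow_mul hs.le, ← mul_assoc, ← Real.rpow_add hs, Real.rpow_neg_one, div_eq_mul_inv]
    congr 2
    ring
  constructor
  · rw [← integrableOn_congr_fun key measurableSet_Ioi,
      integrableOn_Ioi_comp_rpow_iff (fun t : ℝ => t ^ (a - 1) * Real.exp (-(B * t))) (by norm_num)]
    have := integrableOn_rpow_mul_exp_neg_mul_rpow (p := 1) (s := a - 1) (b := B) (by linarith) one_pos hB
    simpa using this
  · rw [← setIntegral_congr_fun measurableSet_Ioi key]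
    rw [integral_comp_rpow_Ioi (fun t : ℝ => t ^ (a - 1) * Real.exp (-(B * t))) (by norm_num),
      Real.integral_rpow_mul_exp_neg_mul_Ioi ha hB, one_div, Real.inv_rpow hB.le,
      Real.rpow_neg hB.le, mul_comm]

lemma lm_invgamma_lint (a B : ℝ) (ha : 0 < a) (hB : 0 < B) :
    ∫⁻ s in Ioi (0:ℝ), ENNReal.ofReal (s ^ (-a - 1) * Real.exp (-(B / s)))
      = ENNReal.ofReal (Real.Gamma a * B ^ (-a)) := by
  obtain ⟨h1, h2⟩ := lm_invgamma a B ha hB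
  rw [← h2, ofReal_integral_eq_lintegral_ofReal h1]
  filter_upwards [ae_restrict_mem measurableSet_Ioi] with s hs
  have hs : 0 < s := hs
  show 0 ≤ _
  positivity

lemma lm_gauss (b m : ℝ) (hb : 0 < b) :
    ∫⁻ x : ℝ, ENNReal.ofReal (Real.exp (-b * (x - m) ^ 2))
      = ENNReal.ofReal (Real.sqrt (Real.pi / b)) := by
  rw [lintegral_sub_right_eq_self (fun x => ENNReal.ofReal (Real.exp (-b * x ^ 2))) m,
    ← integral_gaussian, ofReal_integral_eq_lintegral_ofReal (integrable_exp_neg_mul_sq hb)]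
  exact Filter.Eventually.of_forall (fun x => (Real.exp_pos _).le)

lemma lm_affine (m w : ℝ) (hw : 0 < w) (f : ℝ → ENNReal) (hf : Measurable f) :
    ∫⁻ x, f x = ENNReal.ofReal w * ∫⁻ t, f (m + w * t) := by
  have h1 : ∫⁻ x, f x = ∫⁻ x, f (m + x) := (lintegral_add_left_eq_self f m).symm
  rw [h1]
  have h2 := Real.smul_map_volume_mul_left hw.ne'
  conv_lhs => rw [← h2]
  rw [lintegral_smul_measure, lintegral_map (by fun_prop) (by fun_prop), abs_of_pos hw]
  rfl

lemma lm_tpos (d : ℝ) (hd : 0 < d) : 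
    0 < Real.Gamma ((d + 1) / 2) / (Real.sqrt (d * Real.pi) * Real.Gamma (d / 2)) := by
  have := Real.Gamma_pos_of_pos (show 0 < (d+1)/2 by linarith)
  have := Real.Gamma_pos_of_pos (show 0 < d/2 by linarith)
  have := Real.pi_pos
  positivity

lemma lm_stdT_univ (d : ℝ) (hd : 0 < d) : stdT d univ = 1 := by
  have hG1 := Real.Gamma_pos_of_pos (show 0 < (d+1)/2 by linarith)
  have hG2 := Real.Gamma_pos_of_pos (show 0 < d/2 by linarith)
  have hpi := Real.pi_pos
  rw [stdT, withDensity_apply _ MeasurableSet.univ, Measure.restrict_univ]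
  have e1 : ∀ x, ENNReal.ofReal (stdTPdf d x) =
      ENNReal.ofReal (1 / (Real.sqrt (d * Real.pi) * Real.Gamma (d / 2))) *
      ∫⁻ s in Ioi (0:ℝ), ENNReal.ofReal (s ^ (-((d+1)/2) - 1) * Real.exp (-((1 + x^2/d) / s))) := by
    intro x
    rw [lm_invgamma_lint _ _ (by linarith) (by positivity), ← ENNReal.ofReal_mul (by positivity)]
    congr 1
    unfold stdTPdf
    ring
  simp_rw [e1]
  rw [lintegral_const_mul' _ _ ENNReal.ofReal_ne_top, lintegral_lintegral_swap
    (Measurable.aemeasurable (by fun_prop))]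
  have e2 : ∀ s ∈ Ioi (0:ℝ), 
      ∫⁻ x : ℝ, ENNReal.ofReal (s ^ (-((d+1)/2) - 1) * Real.exp (-((1 + x^2/d) / s)))
       = ENNReal.ofReal (Real.sqrt (d * Real.pi)) *
          ENNReal.ofReal (s ^ (-(d/2) - 1) * Real.exp (-(1 / s))) := by
    intro s hs
    have hs : 0 < s := hs
    have e3 : ∀ x : ℝ, ENNReal.ofReal (s ^ (-((d+1)/2) - 1) * Real.exp (-((1 + x^2/d) / s)))
      = ENNReal.ofReal (s ^ (-((d+1)/2) - 1) * Real.exp (-(1 / s))) *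
        ENNReal.ofReal (Real.exp (-(1/(d*s)) * (x - 0)^2)) := by
      intro x
      rw [← ENNReal.ofReal_mul (by positivity), mul_assoc, ← Real.exp_add]
      congr 3
      field_simp
      ring
    simp_rw [e3]
    rw [lintegral_const_mul' _ _ ENNReal.ofReal_ne_top, lm_gauss _ _ (by positivity),
      ← ENNReal.ofReal_mul (by positivity), ← ENNReal.ofReal_mul (by positivity)]
    congr 1
    have : Real.pi / (1 / (d * s)) = (d * Real.pi) * s := by field_simp
    rw [this, Real.sqrt_mul (by positivity)]
    have : s ^ (-(d/2) - 1) = s ^ (-((d+1)/2) - 1) * Real.sqrt s := by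
      rw [Real.sqrt_eq_rpow, ← Real.rpow_add hs]
      congr 1
      ring
    rw [this]
    ring
  rw [setLIntegral_congr_fun measurableSet_Ioi e2, lintegral_const_mul' _ _ ENNReal.ofReal_ne_top,
    lm_invgamma_lint _ _ (by linarith) one_pos, ← ENNReal.ofReal_mul (by positivity),
    ← ENNReal.ofReal_mul (by positivity), Real.one_rpow]
  rw [← ENNReal.ofReal_one]
  congr 1
  have : Real.sqrt (d * Real.pi) ≠ 0 := by positivity
  field_simp

lemma lm_stdT_symm (d t : ℝ) : stdT d (Iio (-t)) = stdT d (Ioi t) := by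
  rw [stdT, withDensity_apply _ measurableSet_Iio, withDensity_apply _ measurableSet_Ioi,
    ← lintegral_indicator measurableSet_Iio, ← lintegral_indicator measurableSet_Ioi,
    ← lintegral_neg_eq_self]
  congr 1
  ext x
  simp only [Set.indicator, Set.mem_Iio, Set.mem_Ioi, neg_lt_neg_iff]
  simp [stdTPdf]

lemma lm_stdT_Icc (d : ℝ) (hd : 0 < d) (α t : ℝ) (hα : α ∈ Ioo (0:ℝ) 1)
    (h : stdT d (Ioi t) = ENNReal.ofReal (α / 2)) :
    stdT d (Icc (-t) t) = ENNReal.ofReal (1 - α) := by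
  have h' := lm_stdT_symm d t
  rw [h] at h'
  have hu := lm_stdT_univ d hd
  have hsum : ENNReal.ofReal (α/2) + ENNReal.ofReal (α/2) = ENNReal.ofReal α := by
    rw [← ENNReal.ofReal_add (by linarith [hα.1]) (by linarith [hα.1])]; congr 1; ring
  have hle : stdT d (Iio (-t) ∪ Ioi t) ≤ ENNReal.ofReal α := by
    refine (measure_union_le _ _).trans ?_
    rw [h, h', hsum]
  have ht : 0 ≤ t := by
    by_contra hlt
    push Not at hlt
    have : Iio (-t) ∪ Ioi t = univ := by
      ext x; simp only [Set.mem_union, Set.mem_Iio, Set.mem_Ioi, Set.mem_univ, iff_true]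
      by_contra hc; push Not at hc; linarith
    rw [this, hu] at hle
    have := hα.2
    have h2 : ENNReal.ofReal α < 1 := by rw [← ENNReal.ofReal_one]; exact (ENNReal.ofReal_lt_ofReal_iff one_pos).2 this
    exact absurd hle (not_le.2 h2)
  have hun : stdT d (Iio (-t) ∪ Ioi t) = ENNReal.ofReal α := by
    rw [measure_union _ measurableSet_Ioi, h, h', hsum]
    rw [Set.disjoint_left]; intro x hx hx2
    simp only [Set.mem_Iio, Set.mem_Ioi] at hx hx2; linarith
  have hc : Icc (-t) t = (Iio (-t) ∪ Ioi t)ᶜ := by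
    ext x; simp
  rw [hc, measure_compl (measurableSet_Iio.union measurableSet_Ioi) (by rw [hun]; exact ENNReal.ofReal_ne_top), hu, hun,
    ENNReal.ofReal_sub _ hα.1.le, ENNReal.ofReal_one]

lemma lm_SS (N C : ℕ) (hN : 4 ≤ N) (hC : 2 ≤ C) (Y : Fin N → Fin C → ℝ) (μ : Fin C → ℝ) :
    ∑ i, ∑ j', (Y i j' - μ j' - bhat N C Y i) ^ 2 =
      SSint N C Y + N * ∑ k, (μ k - condMean N C Y k) ^ 2 := by
  have hN0 : (N:ℝ) ≠ 0 := by positivity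
  have hC0 : (C:ℝ) ≠ 0 := by positivity
  have hs : ∀ i, ∑ k, Y i k = C * subjMean N C Y i := by
    intro i; unfold subjMean; field_simp
  have hc : ∀ k, ∑ i, Y i k = N * condMean N C Y k := by
    intro i; unfold condMean; field_simp
  have hg : ∑ i, subjMean N C Y i = N * grandMean N C Y := by
    unfold subjMean grandMean; rw [← Finset.sum_div]; field_simp
  have hb : ∑ i, bhat N C Y i = 0 := by
    unfold bhat; rw [Finset.sum_sub_distrib, hg]; simp
  have hb2 : ∑ i, bhat N C Y i ^ 2 = ∑ i, subjMean N C Y i ^ 2 - N * grandMean N C Y ^ 2 := by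
    have : ∀ i, bhat N C Y i ^ 2 = subjMean N C Y i ^ 2 - 2 * grandMean N C Y * subjMean N C Y i + grandMean N C Y ^ 2 := by
      intro i; unfold bhat; ring
    simp_rw [this]
    rw [Finset.sum_add_distrib, Finset.sum_sub_distrib, ← Finset.mul_sum, hg]
    simp; ring
  have hbm : ∑ i, bhat N C Y i * subjMean N C Y i = ∑ i, subjMean N C Y i ^ 2 - N * grandMean N C Y ^ 2 := by
    have : ∀ i, bhat N C Y i * subjMean N C Y i = subjMean N C Y i ^ 2 - grandMean N C Y * subjMean N C Y i := by
      intro i; unfold bhat; ring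
    simp_rw [this]
    rw [Finset.sum_sub_distrib, ← Finset.mul_sum, hg]
    ring
  have e : ∀ i k, (Y i k - μ k - bhat N C Y i) ^ 2 = Y i k ^ 2 + μ k ^ 2 + bhat N C Y i ^ 2
      - 2 * (μ k * Y i k) - 2 * (bhat N C Y i * Y i k) + 2 * (bhat N C Y i * μ k) := by
    intro i k; ring
  have c1 : ∑ i, ∑ k, μ k * Y i k = N * ∑ k, μ k * condMean N C Y k := by
    rw [Finset.sum_comm, Finset.mul_sum]
    refine Finset.sum_congr rfl fun k _ => ?_
    rw [← Finset.mul_sum, hc]; ring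
  have c2 : ∑ i, ∑ k, bhat N C Y i * Y i k = C * (∑ i, subjMean N C Y i ^ 2 - N * grandMean N C Y ^ 2) := by
    rw [← hbm, Finset.mul_sum]
    refine Finset.sum_congr rfl fun k _ => ?_
    rw [← Finset.mul_sum, hs]; ring
  have c3 : ∑ i, ∑ k, bhat N C Y i * μ k = 0 := by
    rw [← Finset.sum_mul_sum, hb, zero_mul]
  have c4 : ∑ k, (μ k - condMean N C Y k) ^ 2 = ∑ k, μ k ^ 2 - 2 * ∑ k, μ k * condMean N C Y k + ∑ k, condMean N C Y k ^ 2 := by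
    rw [Finset.mul_sum, ← Finset.sum_sub_distrib, ← Finset.sum_add_distrib]
    refine Finset.sum_congr rfl fun k _ => ?_
    ring
  simp_rw [e, Finset.sum_add_distrib, Finset.sum_sub_distrib, Finset.sum_add_distrib, ← Finset.mul_sum]
  simp_rw [← Finset.mul_sum] at c1 c2 c3
  rw [c1, c2, c3, c4]
  simp only [Finset.sum_const, Finset.card_univ, Fintype.card_fin, nsmul_eq_mul, ← Finset.mul_sum]
  rw [hb2, SSint]
  ring

lemma lm_map (N C : ℕ) (hN : 4 ≤ N) (hC : 2 ≤ C) (S : ℝ) (hS : 0 < S) (M : Fin C → ℝ) (j : Fin C)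
    (A : Set ℝ) (hA : MeasurableSet A) :
    ∫⁻ μ : Fin C → ℝ in (fun μ => μ j) ⁻¹' A, ENNReal.ofReal (∫ s in Ioi (0 : ℝ), s ^ (((N : ℝ) - 3) / 2 - ((N : ℝ) * C) / 2) *
        Real.exp (-(1 / (2 * s)) * (S + N * ∑ k, (μ k - M k) ^ 2)))
    = ENNReal.ofReal (Real.sqrt (2 * Real.pi / N) ^ (C - 1)) * 
      ∫⁻ x in A, ENNReal.ofReal (Real.Gamma ((((N : ℝ) - 1) * ((C : ℝ) - 1) + 1) / 2) *
        ((S + N * (x - M j)^2) / 2) ^ (-((((N : ℝ) - 1) * ((C : ℝ) - 1) + 1) / 2))) := by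
  have hN' : (4:ℝ) ≤ N := by exact_mod_cast hN
  have hC' : (2:ℝ) ≤ C := by exact_mod_cast hC
  have hpi := Real.pi_pos
  set ν : ℝ := ((N : ℝ) - 1) * ((C : ℝ) - 1) with hν
  have hνpos : 0 < ν := mul_pos (by linarith) (by linarith)
  set e : ℝ := ((N : ℝ) - 3) / 2 - ((N : ℝ) * C) / 2 with he
  have ha : 0 < -e - 1 := by rw [he]; nlinarith
  have hee : e = -(-e - 1) - 1 := by ring
  have s1 : ∀ μ : Fin C → ℝ, ENNReal.ofReal (∫ s in Ioi (0 : ℝ), s ^ e *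
        Real.exp (-(1 / (2 * s)) * (S + N * ∑ k, (μ k - M k) ^ 2)))
      = ∫⁻ s in Ioi (0:ℝ), ENNReal.ofReal (s ^ e *
        Real.exp (-(1 / (2 * s)) * (S + N * ∑ k, (μ k - M k) ^ 2))) := by
    intro μ
    have hB : 0 < (S + N * ∑ k, (μ k - M k) ^ 2) / 2 := by positivity
    have hh : ∀ s : ℝ, s ^ e * Real.exp (-(1 / (2 * s)) * (S + N * ∑ k, (μ k - M k) ^ 2))
      = s ^ (-(-e - 1) - 1) * Real.exp (-(((S + N * ∑ k, (μ k - M k) ^ 2) / 2) / s)) := by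
      intro s
      rw [← hee]
      congr 2
      ring
    simp_rw [hh]
    rw [lm_invgamma_lint _ _ ha hB, (lm_invgamma _ _ ha hB).2]
  simp_rw [s1]
  rw [lintegral_lintegral_swap (Measurable.aemeasurable (by fun_prop))]
  have s2 : ∀ s ∈ Ioi (0:ℝ), ∫⁻ μ : Fin C → ℝ in (fun μ => μ j) ⁻¹' A, ENNReal.ofReal (s ^ e *
        Real.exp (-(1 / (2 * s)) * (S + N * ∑ k, (μ k - M k) ^ 2)))
      = ENNReal.ofReal (Real.sqrt (2 * Real.pi / N) ^ (C - 1)) * ∫⁻ x in A, 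
        ENNReal.ofReal (s ^ (-((ν+1)/2) - 1) * Real.exp (-(((S + N * (x - M j)^2) / 2) / s))) := by
    intro s hs
    have hs : 0 < s := hs
    let f : Fin C → ℝ → ENNReal := fun k x => 
      (if k = j then A.indicator 1 x else 1) * ENNReal.ofReal (Real.exp (-(N / (2 * s)) * (x - M k)^2))
    have hf : ∀ k, Measurable (f k) := by
      intro k
      have : Measurable (A.indicator (1 : ℝ → ENNReal)) := measurable_one.indicator hA
      by_cases hk : k = j <;> simp only [f, hk, if_true, if_false] <;> fun_prop
    rw [← lintegral_indicator (measurable_pi_apply j hA)]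
    have t1 : ∀ μ : Fin C → ℝ, ((fun μ : Fin C → ℝ => μ j) ⁻¹' A).indicator (fun μ => ENNReal.ofReal (s ^ e *
        Real.exp (-(1 / (2 * s)) * (S + N * ∑ k, (μ k - M k) ^ 2)))) μ
        = ENNReal.ofReal (s ^ e * Real.exp (-(S / (2 * s)))) * ∏ k, f k (μ k) := by
      intro μ
      simp only [f, Finset.prod_mul_distrib, Finset.prod_ite_eq', Finset.mem_univ, if_true]
      rw [← ENNReal.ofReal_prod_of_nonneg (fun _ _ => (Real.exp_pos _).le), ← Real.exp_sum,
        ← Finset.mul_sum, mul_left_comm, ← ENNReal.ofReal_mul (by positivity), mul_assoc, ← Real.exp_add]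
      by_cases hm : μ j ∈ A
      · have hm' : μ ∈ (fun μ : Fin C → ℝ => μ j) ⁻¹' A := hm
        rw [Set.indicator_of_mem hm', Set.indicator_of_mem hm]
        simp only [Pi.one_apply, one_mul]
        congr 3
        ring
      · have hm' : μ ∉ (fun μ : Fin C → ℝ => μ j) ⁻¹' A := hm
        rw [Set.indicator_of_notMem hm', Set.indicator_of_notMem hm, zero_mul]
    simp_rw [t1]
    rw [lintegral_const_mul' _ _ ENNReal.ofReal_ne_top, lm_lint_pi _ _ hf,
      ← Finset.mul_prod_erase _ _ (Finset.mem_univ j)]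
    have t2 : ∀ k ∈ Finset.univ.erase j, ∫⁻ x, f k x = ENNReal.ofReal (Real.sqrt (2 * Real.pi / N) * Real.sqrt s) := by
      intro k hk
      have hk : k ≠ j := (Finset.mem_erase.1 hk).1
      simp only [f, hk, if_false, one_mul]
      rw [lm_gauss _ _ (by positivity), ← Real.sqrt_mul (by positivity)]
      congr 2
      field_simp
    rw [Finset.prod_congr rfl t2, Finset.prod_const, Finset.card_erase_of_mem (Finset.mem_univ j),
      Finset.card_univ, Fintype.card_fin, ← ENNReal.ofReal_pow (by positivity), mul_pow]
    have t3 : ∫⁻ x, f j x = ∫⁻ x in A, ENNReal.ofReal (Real.exp (-(N / (2 * s)) * (x - M j)^2)) := by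
      rw [← lintegral_indicator hA]
      congr 1
      ext x
      by_cases hx : x ∈ A <;> simp [f, hx]
    rw [t3]
    have t4 : ∀ x, ENNReal.ofReal (s ^ (-((ν+1)/2) - 1) * Real.exp (-(((S + N * (x - M j)^2) / 2) / s)))
       = ENNReal.ofReal (s ^ e * Real.exp (-(S / (2 * s))) * Real.sqrt s ^ (C - 1)) *
         ENNReal.ofReal (Real.exp (-(N / (2 * s)) * (x - M j)^2)) := by
      intro x
      rw [← ENNReal.ofReal_mul (by positivity)]
      congr 1
      have q1 : s ^ (-((ν+1)/2) - 1) = s ^ e * Real.sqrt s ^ (C - 1) := by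
        rw [Real.sqrt_eq_rpow, ← Real.rpow_natCast, ← Real.rpow_mul hs.le, ← Real.rpow_add hs]
        congr 1
        rw [he, hν, Nat.cast_sub (by omega)]
        push_cast
        ring
      have q2 : Real.exp (-(((S + N * (x - M j)^2) / 2) / s)) =
          Real.exp (-(S / (2 * s))) * Real.exp (-(N / (2 * s)) * (x - M j)^2) := by
        rw [← Real.exp_add]; congr 1; field_simp; ring
      rw [q1, q2]; ring
    simp_rw [t4]
    rw [lintegral_const_mul' _ _ ENNReal.ofReal_ne_top, ENNReal.ofReal_mul (p := Real.sqrt _ ^ _) (by positivity),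
      ENNReal.ofReal_mul (p := s ^ e * _) (by positivity)]
    ring
  rw [setLIntegral_congr_fun measurableSet_Ioi s2, lintegral_const_mul' _ _ ENNReal.ofReal_ne_top,
    lintegral_lintegral_swap (Measurable.aemeasurable (by fun_prop))]
  congr 1
  congr 1
  ext x
  exact lm_invgamma_lint _ _ (by linarith) (by positivity)

/-- Under the improper prior `π(μ, σ²) ∝ (σ²)^((N−3)/2)`, the conditional posterior of
`μ_j` given the data and the plug-in random effects `b̂_i = M_i· − M` is
`t_{(N−1)(C−1)}(M_·j, SS_{S×C}/(N(N−1)(C−1)))`; hence the resulting `1−α`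
within-subject HDI is exactly the Loftus–Masson interval
`M_·j ± sqrt(SS_{S×C}/(N(N−1)(C−1)))·t_{(N−1)(C−1), α/2}`. -/
theorem loftus_masson_prior_posterior (N C : ℕ) (hN : 4 ≤ N) (hC : 2 ≤ C)
    (Y : Fin N → Fin C → ℝ) (hSS : 0 < SSint N C Y) (j : Fin C) :
    let g : (Fin C → ℝ) → ℝ := fun μ =>
      ∫ s in Set.Ioi (0 : ℝ), s ^ (((N : ℝ) - 3) / 2 - ((N : ℝ) * C) / 2) *
        Real.exp (-(1 / (2 * s)) * ∑ i, ∑ j', (Y i j' - μ j' - bhat N C Y i) ^ 2)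
    let P : Measure (Fin C → ℝ) :=
      (volume : Measure (Fin C → ℝ)).withDensity fun μ => ENNReal.ofReal (g μ)
    let ν : ℝ := ((N : ℝ) - 1) * ((C : ℝ) - 1)
    let ω2 : ℝ := SSint N C Y / ((N : ℝ) * ((N : ℝ) - 1) * ((C : ℝ) - 1))
    (∃ c > 0, Measure.map (fun μ : Fin C → ℝ => μ j) P
        = (volume : Measure ℝ).withDensity fun x => ENNReal.ofReal
            (c * (1 + (x - condMean N C Y j) ^ 2 / (ν * ω2)) ^ (-((ν + 1) / 2)))) ∧
      ∀ α ∈ Set.Ioo (0 : ℝ) 1, ∀ tstar : ℝ,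
        stdT ν (Set.Ioi tstar) = ENNReal.ofReal (α / 2) →
        ((P Set.univ)⁻¹ • Measure.map (fun μ : Fin C → ℝ => μ j) P)
            (Set.Icc (condMean N C Y j - Real.sqrt ω2 * tstar)
              (condMean N C Y j + Real.sqrt ω2 * tstar))
          = ENNReal.ofReal (1 - α) := by
  intro g P ν ω2
  have hN' : (4:ℝ) ≤ N := by exact_mod_cast hN
  have hC' : (2:ℝ) ≤ C := by exact_mod_cast hC
  have hpi := Real.pi_pos
  have hνpos : 0 < ν := mul_pos (by linarith) (by linarith)
  have hden : 0 < (N : ℝ) * ((N : ℝ) - 1) * ((C : ℝ) - 1) :=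
    mul_pos (mul_pos (by linarith) (by linarith)) (by linarith)
  have hω : 0 < ω2 := div_pos hSS hden
  have hνω : ν * ω2 = SSint N C Y / N := by
    have h1 : (N:ℝ) - 1 ≠ 0 := by linarith
    have h2 : (C:ℝ) - 1 ≠ 0 := by linarith
    simp only [ν, ω2]
    field_simp
  have hG : 0 < Real.Gamma ((ν + 1) / 2) := Real.Gamma_pos_of_pos (by linarith)
  have hfirst : ∃ c > 0, Measure.map (fun μ : Fin C → ℝ => μ j) P
        = (volume : Measure ℝ).withDensity fun x => ENNReal.ofReal
            (c * (1 + (x - condMean N C Y j) ^ 2 / (ν * ω2)) ^ (-((ν + 1) / 2))) := by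
    refine ⟨Real.sqrt (2 * Real.pi / N) ^ (C - 1) * (Real.Gamma ((ν + 1) / 2) *
      (SSint N C Y / 2) ^ (-((ν + 1) / 2))), by positivity, ?_⟩
    ext A hA
    rw [Measure.map_apply (measurable_pi_apply j) hA, withDensity_apply _ hA,
      withDensity_apply _ (measurable_pi_apply j hA)]
    simp only [g]
    simp_rw [lm_SS N C hN hC Y]
    rw [lm_map N C hN hC _ hSS _ j A hA, ← lintegral_const_mul' _ _ ENNReal.ofReal_ne_top]
    congr 1
    ext x
    rw [← ENNReal.ofReal_mul (by positivity)]
    congr 1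
    have : (SSint N C Y + N * (x - condMean N C Y j) ^ 2) / 2 =
        (SSint N C Y / 2) * (1 + (x - condMean N C Y j) ^ 2 / (ν * ω2)) := by
      rw [hνω]; field_simp
    rw [this, Real.mul_rpow (by positivity) (by positivity)]
    simp only [ν]
    ring
  refine ⟨hfirst, ?_⟩
  intro α hα t ht
  obtain ⟨c, hc, hmap⟩ := hfirst
  set m := condMean N C Y j with hm
  set w := Real.sqrt ω2 with hw
  have hwpos : 0 < w := Real.sqrt_pos.2 hω
  have hK := lm_tpos ν hνpos
  set K := Real.Gamma ((ν + 1) / 2) / (Real.sqrt (ν * Real.pi) * Real.Gamma (ν / 2)) with hKdef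
  have hgen : ∀ A : Set ℝ, MeasurableSet A → Measure.map (fun μ : Fin C → ℝ => μ j) P A =
      ENNReal.ofReal (w * (c / K)) * stdT ν ((fun u => m + w * u) ⁻¹' A) := by
    intro A hA
    have hA' : MeasurableSet ((fun u : ℝ => m + w * u) ⁻¹' A) :=
      (by fun_prop : Measurable (fun u : ℝ => m + w * u)) hA
    rw [hmap, stdT, withDensity_apply _ hA, withDensity_apply _ hA', ← lintegral_indicator hA,
      ← lintegral_indicator hA', lm_affine m w hwpos _ (Measurable.indicator (by fun_prop) hA),
      ENNReal.ofReal_mul hwpos.le, mul_assoc (ENNReal.ofReal w),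
      ← lintegral_const_mul' (ENNReal.ofReal (c / K)) _ ENNReal.ofReal_ne_top]
    congr 1
    refine lintegral_congr fun u => ?_
    by_cases hu : m + w * u ∈ A
    · have hu' : u ∈ (fun u : ℝ => m + w * u) ⁻¹' A := hu
      rw [Set.indicator_of_mem hu, Set.indicator_of_mem hu', ← ENNReal.ofReal_mul (by positivity)]
      congr 1
      have : (m + w * u - m) ^ 2 / (ν * ω2) = u ^ 2 / ν := by
        rw [← Real.sq_sqrt hω.le, ← hw]; field_simp; ring
      rw [this, stdTPdf, ← hKdef]
      field_simp
    · have hu' : u ∉ (fun u : ℝ => m + w * u) ⁻¹' A := hu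
      rw [Set.indicator_of_notMem hu, Set.indicator_of_notMem hu', mul_zero]
  have hPu : P Set.univ = ENNReal.ofReal (w * (c / K)) := by
    have := hgen Set.univ MeasurableSet.univ
    rw [Measure.map_apply (measurable_pi_apply j) MeasurableSet.univ, Set.preimage_univ,
      Set.preimage_univ, lm_stdT_univ ν hνpos, mul_one] at this
    exact this
  have hpre : (fun u : ℝ => m + w * u) ⁻¹' (Set.Icc (m - w * t) (m + w * t)) = Set.Icc (-t) t := by
    ext u
    simp only [Set.mem_preimage, Set.mem_Icc]
    constructor
    · rintro ⟨h1, h2⟩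
      constructor <;> nlinarith
    · rintro ⟨h1, h2⟩
      constructor <;> nlinarith
  rw [Measure.smul_apply, smul_eq_mul, hgen _ measurableSet_Icc, hPu, hpre,
    lm_stdT_Icc ν hνpos α t hα ht, ← mul_assoc, ENNReal.inv_mul_cancel, one_mul]
  · exact (ENNReal.ofReal_pos.2 (by positivity)).ne'
  · exact ENNReal.ofReal_ne_top
end

section
/- In the homoscedastic mixed model under the Jeffreys prior π(μ, σ_ε²) ∝ 1/σ_ε², the conditional posterior of μ_j given the data Y and the plug-in estimates b̂_i = M_i· − M is t_{C(N−1)}(M_·j, SS_{S×C}/(N(N−1)C)); in particular this posterior is proper whenever SS_{S×C} > 0 and N ≥ 2. -/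
open Finset MeasureTheory Set

lemma invgamma_aux {a b : ℝ} (ha : 0 < a) (hb : 0 < b) :
    IntegrableOn (fun s : ℝ => s ^ (-a - 1) * Real.exp (-(1 / (2 * s)) * b)) (Set.Ioi 0) ∧
    ∫ s in Set.Ioi (0 : ℝ), s ^ (-a - 1) * Real.exp (-(1 / (2 * s)) * b)
      = (b / 2) ^ (-a) * Real.Gamma a := by
  have hb2 : 0 < b / 2 := by positivity
  have key : ∀ x ∈ Set.Ioi (0 : ℝ),
      (|(-1 : ℝ)| * x ^ ((-1 : ℝ) - 1)) •
        ((x ^ (-1 : ℝ)) ^ (a - 1) * Real.exp (-((b / 2) * (x ^ (-1 : ℝ)))))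
      = x ^ (-a - 1) * Real.exp (-(1 / (2 * x)) * b) := by
    intro x hx
    have hx : 0 < x := hx
    rw [smul_eq_mul, abs_neg, abs_one, one_mul, ← mul_assoc, ← Real.rpow_mul hx.le,
      ← Real.rpow_add hx, Real.rpow_neg_one]
    congr 2
    · ring
    · field_simp
  have e := integral_comp_rpow_Ioi
    (fun t : ℝ => t ^ (a - 1) * Real.exp (-((b / 2) * t))) (p := -1) (by norm_num)
  have e2 := integrableOn_Ioi_comp_rpow_iff
    (fun t : ℝ => t ^ (a - 1) * Real.exp (-((b / 2) * t))) (p := -1) (by norm_num)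
  constructor
  · rw [← integrableOn_congr_fun key measurableSet_Ioi]
    refine e2.2 ?_
    have := integrableOn_rpow_mul_exp_neg_mul_rpow (p := 1) (s := a - 1) (b := b / 2)
      (by linarith) one_pos hb2
    simpa [neg_mul] using this
  · rw [← setIntegral_congr_fun measurableSet_Ioi key, e,
      Real.integral_rpow_mul_exp_neg_mul_Ioi ha hb2, one_div, Real.inv_rpow hb2.le,
      Real.rpow_neg hb2.le]

lemma invgamma_lint {a b : ℝ} (ha : 0 < a) (hb : 0 < b) :
    ∫⁻ s in Set.Ioi (0 : ℝ), ENNReal.ofReal (s ^ (-a - 1) * Real.exp (-(1 / (2 * s)) * b))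
      = ENNReal.ofReal (∫ s in Set.Ioi (0 : ℝ), s ^ (-a - 1) * Real.exp (-(1 / (2 * s)) * b)) := by
  rw [ofReal_integral_eq_lintegral_ofReal (invgamma_aux ha hb).1]
  filter_upwards [ae_restrict_mem measurableSet_Ioi] with s hs
  have hs : 0 < s := hs
  positivity

lemma slice_aux {C : ℕ} (j : Fin C) (m : Fin C → ℝ) {n s : ℝ} (hn : 0 < n) (hs : 0 < s)
    {A : Set ℝ} (hA : MeasurableSet A) :
    ∫⁻ μ : Fin C → ℝ in (fun μ : Fin C → ℝ => μ j) ⁻¹' A,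
        ENNReal.ofReal (Real.exp (-(1 / (2 * s)) * (n * ∑ k, (μ k - m k) ^ 2)))
      = ENNReal.ofReal ((2 * Real.pi * s / n) ^ (((C : ℝ) - 1) / 2)) *
        ∫⁻ x in A, ENNReal.ofReal (Real.exp (-(1 / (2 * s)) * (n * (x - m j) ^ 2))) := by
  classical
  have hb : 0 < n / (2 * s) := by positivity
  let E : Fin C → ℝ → ℝ := fun k x => Real.exp (-(1 / (2 * s)) * (n * (x - m k) ^ 2))
  have hE : ∀ k, E k = fun x => (fun y : ℝ => Real.exp (-(n / (2 * s)) * y ^ 2)) (x - m k) := by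
    intro k; funext x; simp only [E]; congr 1; field_simp
  have hEi : ∀ k, Integrable (E k) := by
    intro k; rw [hE]; exact (integrable_exp_neg_mul_sq hb).comp_sub_right (m k)
  have hEv : ∀ k, ∫ x, E k x = (2 * Real.pi * s / n) ^ ((1 : ℝ) / 2) := by
    intro k
    rw [hE, integral_sub_right_eq_self (fun y : ℝ => Real.exp (-(n / (2 * s)) * y ^ 2)) (m k),
      integral_gaussian, Real.sqrt_eq_rpow]
    congr 1; field_simp
  let F : Fin C → ℝ → ℝ := fun k => if k = j then A.indicator (E k) else E k
  have hFi : ∀ k, Integrable (F k) := by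
    intro k; by_cases h : k = j
    · simp only [F, h, if_true]; exact (hEi j).indicator hA
    · simp only [F, h, if_false]; exact hEi k
  have hEpos : ∀ k x, 0 ≤ E k x := fun k x => (Real.exp_pos _).le
  have hFpos : ∀ k x, 0 ≤ F k x := by
    intro k x; by_cases h : k = j
    · simp only [F, h, if_true]; exact Set.indicator_nonneg (fun x _ => hEpos j x) x
    · simp only [F, h, if_false]; exact hEpos k x
  have hpre : MeasurableSet ((fun μ : Fin C → ℝ => μ j) ⁻¹' A) := measurable_pi_apply j hA
  have hprod : ∀ μ : Fin C → ℝ, ∏ k, F k (μ k) =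
      ((fun μ : Fin C → ℝ => μ j) ⁻¹' A).indicator
        (fun μ => Real.exp (-(1 / (2 * s)) * (n * ∑ k, (μ k - m k) ^ 2))) μ := by
    intro μ
    have hexp : Real.exp (-(1 / (2 * s)) * (n * ∑ k, (μ k - m k) ^ 2)) = ∏ k, E k (μ k) := by
      simp only [E]; rw [← Real.exp_sum, Finset.mul_sum, Finset.mul_sum]
    by_cases h : μ j ∈ A
    · rw [Set.indicator_of_mem (by exact h), hexp]
      refine Finset.prod_congr rfl fun k _ => ?_
      by_cases hk : k = j
      · subst hk; simp only [F, if_true]; exact Set.indicator_of_mem h _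
      · simp only [F, hk, if_false]
    · rw [Set.indicator_of_notMem (by exact h)]
      refine Finset.prod_eq_zero (Finset.mem_univ j) ?_
      simp only [F, if_true]; exact Set.indicator_of_notMem h _
  have h1 : ∫⁻ μ : Fin C → ℝ in (fun μ : Fin C → ℝ => μ j) ⁻¹' A,
        ENNReal.ofReal (Real.exp (-(1 / (2 * s)) * (n * ∑ k, (μ k - m k) ^ 2)))
      = ∫⁻ μ : Fin C → ℝ, ENNReal.ofReal (∏ k, F k (μ k)) := by
    rw [← lintegral_indicator hpre]
    refine lintegral_congr fun μ => ?_
    rw [hprod]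
    by_cases h : μ ∈ (fun μ : Fin C → ℝ => μ j) ⁻¹' A
    · rw [Set.indicator_of_mem h, Set.indicator_of_mem h]
    · rw [Set.indicator_of_notMem h, Set.indicator_of_notMem h, ENNReal.ofReal_zero]
  have hint : Integrable (fun μ : Fin C → ℝ => ∏ k, F k (μ k)) :=
    Integrable.fintype_prod (μ := fun _ => volume) hFi
  have hpos : 0 < 2 * Real.pi * s / n := by positivity
  rw [h1, ← ofReal_integral_eq_lintegral_ofReal hint
    (Filter.Eventually.of_forall fun μ => Finset.prod_nonneg fun k _ => hFpos k _),
    integral_fintype_prod_volume_eq_prod, ← Finset.mul_prod_erase _ _ (Finset.mem_univ j)]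
  have h2 : ∏ k ∈ Finset.univ.erase j, ∫ x, F k x
      = (2 * Real.pi * s / n) ^ (((C : ℝ) - 1) / 2) := by
    rw [Finset.prod_congr rfl (g := fun _ => (2 * Real.pi * s / n) ^ ((1 : ℝ) / 2))]
    · have hC : 1 ≤ C := by have := j.2; omega
      rw [Finset.prod_const, Finset.card_erase_of_mem (Finset.mem_univ j), Finset.card_univ,
        Fintype.card_fin, ← Real.rpow_natCast, ← Real.rpow_mul hpos.le, Nat.cast_sub hC]
      congr 1; push_cast; ring
    · intro k hk
      have : k ≠ j := (Finset.mem_erase.1 hk).1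
      simp only [F, this, if_false]; exact hEv k
  have h3 : ENNReal.ofReal (∫ x, F j x) =
      ∫⁻ x in A, ENNReal.ofReal (Real.exp (-(1 / (2 * s)) * (n * (x - m j) ^ 2))) := by
    simp only [F, if_true]
    rw [integral_indicator hA, ofReal_integral_eq_lintegral_ofReal (hEi j).integrableOn
      (Filter.Eventually.of_forall fun x => hEpos j x)]
  rw [h2, mul_comm, ENNReal.ofReal_mul (by positivity), h3]

lemma marg_aux {C : ℕ} (j : Fin C) (m : Fin C → ℝ) {n S p q : ℝ} (hn : 0 < n)
    (hq : q = p - ((C : ℝ) - 1) / 2) {A : Set ℝ} (hA : MeasurableSet A) :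
    ∫⁻ μ : Fin C → ℝ in (fun μ : Fin C → ℝ => μ j) ⁻¹' A, ∫⁻ s in Set.Ioi (0 : ℝ),
        ENNReal.ofReal (s ^ (-p - 1) *
          Real.exp (-(1 / (2 * s)) * (S + n * ∑ k, (μ k - m k) ^ 2)))
      = ∫⁻ x in A, ∫⁻ s in Set.Ioi (0 : ℝ),
        ENNReal.ofReal ((2 * Real.pi / n) ^ (((C : ℝ) - 1) / 2) * (s ^ (-q - 1) *
          Real.exp (-(1 / (2 * s)) * (S + n * (x - m j) ^ 2)))) := by
  refine (lintegral_lintegral_swap ?_).trans (Eq.trans ?_ (lintegral_lintegral_swap ?_).symm)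
  rotate_left 2
  · refine Measurable.aemeasurable ?_
    unfold Function.uncurry
    fun_prop
  · refine Measurable.aemeasurable ?_
    unfold Function.uncurry
    fun_prop
  refine setLIntegral_congr_fun (measurableSet_Ioi (a := (0 : ℝ))) fun s hs => ?_
  have hs : 0 < s := hs
  have hl : ∀ T : ℝ, ENNReal.ofReal (s ^ (-p - 1) * Real.exp (-(1 / (2 * s)) * (S + T)))
      = ENNReal.ofReal (s ^ (-p - 1) * Real.exp (-(1 / (2 * s)) * S)) *
        ENNReal.ofReal (Real.exp (-(1 / (2 * s)) * T)) := by
    intro T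
    rw [← ENNReal.ofReal_mul (by positivity), mul_add, Real.exp_add, mul_assoc]
  have hr : ∀ T : ℝ, ENNReal.ofReal ((2 * Real.pi / n) ^ (((C : ℝ) - 1) / 2) *
        (s ^ (-q - 1) * Real.exp (-(1 / (2 * s)) * (S + T))))
      = ENNReal.ofReal (s ^ (-p - 1) * Real.exp (-(1 / (2 * s)) * S)) *
        ENNReal.ofReal ((2 * Real.pi * s / n) ^ (((C : ℝ) - 1) / 2)) *
        ENNReal.ofReal (Real.exp (-(1 / (2 * s)) * T)) := by
    intro T
    rw [← ENNReal.ofReal_mul (by positivity), ← ENNReal.ofReal_mul (by positivity), mul_add,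
      Real.exp_add]
    have e1 : 2 * Real.pi * s / n = 2 * Real.pi / n * s := by ring
    have e2 : s ^ (-q - 1) = s ^ (-p - 1) * s ^ (((C : ℝ) - 1) / 2) := by
      rw [← Real.rpow_add hs, hq]; congr 1; ring
    rw [e1, Real.mul_rpow (by positivity) hs.le, e2]
    congr 1; ring
  simp only [hl, hr]
  rw [lintegral_const_mul _ (by fun_prop), lintegral_const_mul _ (by fun_prop),
    slice_aux j m hn hs hA, ← mul_assoc]

lemma ss_aux (N C : ℕ) (hN : 2 ≤ N) (hC : 1 ≤ C) (Y : Fin N → Fin C → ℝ) (μ : Fin C → ℝ) :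
    ∑ i, ∑ j', (Y i j' - μ j' - bhat N C Y i) ^ 2
      = SSint N C Y + N * ∑ k, (μ k - condMean N C Y k) ^ 2 := by
  have hN0 : (N : ℝ) ≠ 0 := by positivity
  have hC0 : (C : ℝ) ≠ 0 := by positivity
  have ha : ∀ i, ∑ k, Y i k = C * subjMean N C Y i := by
    intro i; unfold subjMean; field_simp
  have hm : ∀ k, ∑ i, Y i k = N * condMean N C Y k := by
    intro i; unfold condMean; field_simp
  have hM : ∑ i, subjMean N C Y i = N * grandMean N C Y := by
    unfold subjMean grandMean; rw [← Finset.sum_div]; field_simp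
  unfold SSint bhat
  generalize grandMean N C Y = M at *
  generalize subjMean N C Y = a at *
  generalize condMean N C Y = m at *
  have h1 : ∀ i, ∑ k, (Y i k - μ k - (a i - M)) ^ 2
      = ∑ k, Y i k ^ 2 + ∑ k, μ k ^ 2 + C * (a i - M) ^ 2 - 2 * ∑ k, Y i k * μ k
        - 2 * (a i - M) * (C * a i) + 2 * (a i - M) * ∑ k, μ k := by
    intro i
    rw [← ha, Finset.mul_sum, Finset.mul_sum, Finset.mul_sum]
    have : (C : ℝ) * (a i - M) ^ 2 = ∑ k : Fin C, (a i - M) ^ 2 := by simp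
    rw [this, ← Finset.sum_add_distrib, ← Finset.sum_add_distrib, ← Finset.sum_sub_distrib,
      ← Finset.sum_sub_distrib, ← Finset.sum_add_distrib]
    exact Finset.sum_congr rfl fun k _ => by ring
  have h2 : ∑ i, ∑ k, Y i k * μ k = N * ∑ k, m k * μ k := by
    rw [Finset.sum_comm, Finset.mul_sum]
    refine Finset.sum_congr rfl fun k _ => ?_
    rw [← Finset.sum_mul, hm]; ring
  have h3 : ∑ i, (a i - M) = 0 := by
    rw [Finset.sum_sub_distrib, hM]; simp
  have h4 : ∑ i, (a i - M) ^ 2 = ∑ i, a i ^ 2 - N * M ^ 2 := by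
    have : ∀ i, (a i - M) ^ 2 = a i ^ 2 - 2 * M * a i + M ^ 2 := fun i => by ring
    simp only [this, Finset.sum_add_distrib, Finset.sum_sub_distrib, ← Finset.mul_sum, hM]
    simp; ring
  have h5 : ∑ i, 2 * (a i - M) * (C * a i) = 2 * C * (∑ i, a i ^ 2 - N * M ^ 2) := by
    have : ∀ i, 2 * (a i - M) * (C * a i) = 2 * C * a i ^ 2 - 2 * C * M * a i := fun i => by ring
    simp only [this, Finset.sum_sub_distrib, ← Finset.mul_sum, hM]
    ring
  have h6 : ∑ k, (μ k - m k) ^ 2 = ∑ k, μ k ^ 2 - 2 * ∑ k, m k * μ k + ∑ k, m k ^ 2 := by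
    rw [Finset.mul_sum, ← Finset.sum_sub_distrib, ← Finset.sum_add_distrib]
    exact Finset.sum_congr rfl fun k _ => by ring
  simp only [h1, Finset.sum_add_distrib, Finset.sum_sub_distrib]
  rw [h5, h6, ← Finset.sum_mul, ← Finset.mul_sum, ← Finset.mul_sum, ← Finset.mul_sum, h2, h3, h4]
  simp
  ring

lemma tdens_integrable {r q c : ℝ} (hr : 0 < r) (hq : 1 ≤ q) (m : ℝ) :
    Integrable (fun x : ℝ => c * (1 + (x - m) ^ 2 / r) ^ (-q)) := by
  refine Integrable.const_mul ?_ c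
  have h0 : Integrable (fun x : ℝ => (1 + (x / √r) ^ 2)⁻¹) :=
    integrable_inv_one_add_sq.comp_div (Real.sqrt_pos.2 hr).ne'
  have h1 := h0.comp_sub_right m
  refine h1.mono' (Measurable.aestronglyMeasurable (by fun_prop)) (Filter.Eventually.of_forall ?_)
  intro x
  have h2 : 1 ≤ 1 + (x - m) ^ 2 / r := by
    have : 0 ≤ (x - m) ^ 2 / r := by positivity
    linarith
  have h3 : ((x - m) / √r) ^ 2 = (x - m) ^ 2 / r := by
    rw [div_pow, Real.sq_sqrt hr.le]
  rw [Real.norm_of_nonneg (by positivity)]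
  simp only [h3]
  rw [← Real.rpow_neg_one]
  exact Real.rpow_le_rpow_of_exponent_le h2 (by linarith)

/-- Under the Jeffreys prior `π(μ, σ²) ∝ 1/σ²`, the conditional posterior
`p(μ | Y, b̂) ∝ ∫₀^∞ (σ²)^(−NC/2−1) exp(−(1/(2σ²)) Σ_{i,j}(Y_ij − μ_j − b̂_i)²) dσ²`
is proper (a finite measure) whenever `SS_{S×C} > 0` and `N ≥ 2`, and the marginal
posterior of `μ_j` is `t_{C(N−1)}(M_·j, SS_{S×C}/(N(N−1)C))`. -/
theorem jeffreys_within_subject_posterior (N C : ℕ) (hN : 2 ≤ N) (hC : 1 ≤ C)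
    (Y : Fin N → Fin C → ℝ) (hSS : 0 < SSint N C Y) (j : Fin C) :
    let g : (Fin C → ℝ) → ℝ := fun μ =>
      ∫ s in Set.Ioi (0 : ℝ), s ^ (-((N : ℝ) * C) / 2 - 1) *
        Real.exp (-(1 / (2 * s)) * ∑ i, ∑ j', (Y i j' - μ j' - bhat N C Y i) ^ 2)
    let P : Measure (Fin C → ℝ) :=
      (volume : Measure (Fin C → ℝ)).withDensity fun μ => ENNReal.ofReal (g μ)
    let ν : ℝ := (C : ℝ) * ((N : ℝ) - 1)
    let ω2 : ℝ := SSint N C Y / ((N : ℝ) * ((N : ℝ) - 1) * C)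
    IsFiniteMeasure P ∧
      ∃ c > 0, Measure.map (fun μ : Fin C → ℝ => μ j) P
        = (volume : Measure ℝ).withDensity fun x => ENNReal.ofReal
            (c * (1 + (x - condMean N C Y j) ^ 2 / (ν * ω2)) ^ (-((ν + 1) / 2))) := by
  intro g P ν ω2
  have hN1 : (2 : ℝ) ≤ N := by exact_mod_cast hN
  have hC1 : (1 : ℝ) ≤ C := by exact_mod_cast hC
  have hN0 : (0 : ℝ) < N := by linarith
  have hC0 : (0 : ℝ) < C := by linarith
  have hNm : (0 : ℝ) < (N : ℝ) - 1 := by linarith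
  set S := SSint N C Y with hS
  have hνω : ν * ω2 = S / N := by
    simp only [ν, ω2]; rw [← hS]; field_simp
  have hr : 0 < S / N := by positivity
  have hν : 1 ≤ ν := by
    simp only [ν]; nlinarith
  have hq0 : 0 < (ν + 1) / 2 := by linarith
  have hp0 : 0 < (N : ℝ) * C / 2 := by positivity
  let c : ℝ := (2 * Real.pi / N) ^ (((C : ℝ) - 1) / 2) *
    ((S / 2) ^ (-((ν + 1) / 2)) * Real.Gamma ((ν + 1) / 2))
  have hc : 0 < c := by
    have := Real.Gamma_pos_of_pos hq0
    have := Real.pi_pos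
    positivity
  have hg : ∀ μ, ENNReal.ofReal (g μ) = ∫⁻ s in Set.Ioi (0 : ℝ),
      ENNReal.ofReal (s ^ (-((N : ℝ) * C / 2) - 1) *
        Real.exp (-(1 / (2 * s)) * (S + N * ∑ k, (μ k - condMean N C Y k) ^ 2))) := by
    intro μ
    have hT : 0 < S + N * ∑ k, (μ k - condMean N C Y k) ^ 2 := by
      have : 0 ≤ ∑ k, (μ k - condMean N C Y k) ^ 2 := Finset.sum_nonneg fun k _ => sq_nonneg _
      positivity
    rw [invgamma_lint hp0 hT]
    simp only [g]
    rw [ss_aux N C hN hC Y μ, neg_div]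
  have hmap : Measure.map (fun μ : Fin C → ℝ => μ j) P
        = (volume : Measure ℝ).withDensity fun x => ENNReal.ofReal
            (c * (1 + (x - condMean N C Y j) ^ 2 / (ν * ω2)) ^ (-((ν + 1) / 2))) := by
    ext A hA
    rw [Measure.map_apply (measurable_pi_apply j) hA, withDensity_apply _ hA]
    simp only [P]
    rw [withDensity_apply _ (measurable_pi_apply j hA)]
    simp only [hg]
    rw [marg_aux j (condMean N C Y) (q := (ν + 1) / 2) hN0 (by simp only [ν]; ring) hA]
    refine lintegral_congr fun x => ?_
    have hx : 0 < S + N * (x - condMean N C Y j) ^ 2 := by positivity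
    have hK : 0 ≤ (2 * Real.pi / N) ^ (((C : ℝ) - 1) / 2) := by
      have := Real.pi_pos
      positivity
    simp only [ENNReal.ofReal_mul hK]
    rw [lintegral_const_mul _ (by fun_prop), invgamma_lint hq0 hx, (invgamma_aux hq0 hx).2,
      ← ENNReal.ofReal_mul hK, hνω]
    congr 1
    have e : (S + N * (x - condMean N C Y j) ^ 2) / 2
        = S / 2 * (1 + (x - condMean N C Y j) ^ 2 / (S / N)) := by
      field_simp
    rw [e, Real.mul_rpow (by positivity) (by positivity)]
    simp only [c]
    ring
  refine ⟨⟨?_⟩, c, hc, hmap⟩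
  have h1 : P Set.univ = Measure.map (fun μ : Fin C → ℝ => μ j) P Set.univ := by
    rw [Measure.map_apply (measurable_pi_apply j) MeasurableSet.univ, Set.preimage_univ]
  rw [h1, hmap, withDensity_apply _ MeasurableSet.univ, Measure.restrict_univ, hνω]
  exact (tdens_integrable hr (by linarith) _).lintegral_lt_top
end
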